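/- Fix monotone activation functions (f_v)_{v ∈ V}, thresholds θ ∈ [0,1]^V, and let Fix_θ denote the diffusion fixed-point operator. Suppose each f_v is additionally submodular. Then for any sets A, B ⊆ V there exist thresholds θ', θ'', θ''', θ'''' ∈ [0,1]^V, each coordinate being either θ_v or a measure-preserving transformation of it, such that the corresponding final sets A_∞, B_∞, C_∞, D_∞ of the coupled processes started from A, B, A ∩ B, A ∪ B satisfy C_∞ ⊆ A_∞ ∩ B_∞ and D_∞ ⊆ A_∞ ∪ B_∞. Consequently, for monotone submodular w : 2^V → ℝ₊, the influence σ_w(S) = E[w(Fix_Θ(S))] with Θ uniform on [0,1]^V is submodular: σ_w(A) + σ_w(B) ≥ σ_w(A ∩ B) + σ_w(A ∪ B). -/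

import Mathlib

open MeasureTheory

/-- `Fx θ S` is the least set containing `S` closed under activation with thresholds `θ`. -/
structure IsFixOp {V : Type*} [DecidableEq V] (f : V → Finset V → ℝ)
    (Fx : (V → ℝ) → Finset V → Finset V) : Prop where
  sub : ∀ θ S, S ⊆ Fx θ S
  closed : ∀ θ S v, θ v ≤ f v (Fx θ S) → v ∈ Fx θ S
  least : ∀ θ S X, S ⊆ X → (∀ v, θ v ≤ f v X → v ∈ X) → Fx θ S ⊆ X

open scoped Classical in
/-- Reflect the thresholds outside `T`. -/
noncomputable def refl_thr {V : Type*} (f : V → Finset V → ℝ) (T : Finset V) (θ : V → ℝ) :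
    V → ℝ := fun v => if v ∈ T then θ v else 1 + f v T - θ v

theorem refl_thr_invol {V : Type*} (f : V → Finset V → ℝ) (T : Finset V) (θ : V → ℝ) :
    refl_thr f T (refl_thr f T θ) = θ := by
  funext v
  unfold refl_thr
  split_ifs <;> ring

theorem isFixOp_of_iter {V : Type*} [DecidableEq V] [Fintype V] (f : V → Finset V → ℝ)
    (hmono : ∀ v : V, ∀ S T : Finset V, S ⊆ T → f v S ≤ f v T)
    (Fx : (V → ℝ) → Finset V → Finset V) (step : (V → ℝ) → Finset V → Finset V)
    (hstep : ∀ θ T v, v ∈ step θ T ↔ v ∈ T ∨ θ v ≤ f v T)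
    (hFx : ∀ θ S, Fx θ S = (step θ)^[Fintype.card V] S) : IsFixOp f Fx := by
  have hinc : ∀ θ T, T ⊆ step θ T := fun θ T v hv => (hstep θ T v).2 (Or.inl hv)
  have hkey : ∀ θ S n, step θ ((step θ)^[n] S) = (step θ)^[n] S ∨ n ≤ ((step θ)^[n] S).card := by
    intro θ S n
    induction n with
    | zero => right; exact Nat.zero_le _
    | succ k ih =>
      rw [Function.iterate_succ_apply']
      by_cases h : step θ ((step θ)^[k] S) = (step θ)^[k] S
      · left; rw [h, h]
      · right
        have h1 := ih.resolve_left h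
        have h2 : (step θ)^[k] S ⊂ step θ ((step θ)^[k] S) :=
          (hinc θ _).ssubset_of_ne (Ne.symm h)
        have := Finset.card_lt_card h2
        omega
  refine ⟨?_, ?_, ?_⟩
  · intro θ S
    rw [hFx]
    generalize Fintype.card V = n
    induction n with
    | zero => exact subset_rfl
    | succ k ih => rw [Function.iterate_succ_apply']; exact ih.trans (hinc θ _)
  · intro θ S v hv
    rw [hFx] at hv ⊢
    rcases hkey θ S (Fintype.card V) with h | h
    · rw [← h]; exact (hstep _ _ _).2 (Or.inr hv)
    · have : (step θ)^[Fintype.card V] S = Finset.univ :=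
        Finset.eq_univ_of_card _ (le_antisymm (Finset.card_le_univ _) h)
      rw [this]; exact Finset.mem_univ v
  · intro θ S X hS hX
    rw [hFx]
    generalize Fintype.card V = n
    induction n with
    | zero => exact hS
    | succ k ih =>
      rw [Function.iterate_succ_apply']
      intro v hv
      rcases (hstep _ _ _).1 hv with h | h
      · exact ih h
      · exact hX v (h.trans (hmono v _ _ ih))

section
variable {V : Type*} [DecidableEq V] {f : V → Finset V → ℝ}
  {Fx : (V → ℝ) → Finset V → Finset V}

theorem IsFixOp.mono (h : IsFixOp f Fx) (θ : V → ℝ) {S T : Finset V} (hST : S ⊆ T) :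
    Fx θ S ⊆ Fx θ T :=
  h.least _ _ _ (hST.trans (h.sub θ T)) (h.closed θ T)

theorem IsFixOp.sub_of_eq (h : IsFixOp f Fx)
    (hmono : ∀ v : V, ∀ S T : Finset V, S ⊆ T → f v S ≤ f v T)
    (θ θ' : V → ℝ) (S : Finset V) (he : ∀ v ∈ Fx θ S, θ' v = θ v) : Fx θ S ⊆ Fx θ' S := by
  have : Fx θ S ⊆ Fx θ S ∩ Fx θ' S := by
    refine h.least _ _ _ (Finset.subset_inter (h.sub _ _) (h.sub _ _)) ?_
    intro v hv
    have h1 := h.closed θ S v (hv.trans (hmono v _ _ Finset.inter_subset_left))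
    refine Finset.mem_inter.2 ⟨h1, h.closed θ' S v ?_⟩
    rw [he v h1]
    exact hv.trans (hmono v _ _ Finset.inter_subset_right)
  exact this.trans Finset.inter_subset_right

theorem IsFixOp.sub_refl (h : IsFixOp f Fx)
    (hmono : ∀ v : V, ∀ S T : Finset V, S ⊆ T → f v S ≤ f v T)
    (θ : V → ℝ) (S : Finset V) : Fx θ S ⊆ Fx (refl_thr f (Fx θ S) θ) S := by
  refine h.sub_of_eq hmono _ _ _ ?_
  intro v hv
  simp [refl_thr, hv]

theorem IsFixOp.couple_inter (h : IsFixOp f Fx)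
    (hmono : ∀ v : V, ∀ S T : Finset V, S ⊆ T → f v S ≤ f v T)
    (θ : V → ℝ) (A B : Finset V) :
    Fx θ (A ∩ B) ⊆ Fx θ A ∩ Fx (refl_thr f (Fx θ (A ∩ B)) θ) B :=
  Finset.subset_inter (h.mono θ Finset.inter_subset_left)
    ((h.sub_refl hmono θ (A ∩ B)).trans (h.mono _ Finset.inter_subset_right))

theorem IsFixOp.couple_union (h : IsFixOp f Fx)
    (hmono : ∀ v : V, ∀ S T : Finset V, S ⊆ T → f v S ≤ f v T)
    (hsub : ∀ v : V, ∀ S T : Finset V, f v (S ∩ T) + f v (S ∪ T) ≤ f v S + f v T)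
    (θ : V → ℝ) (A B : Finset V) :
    Fx (refl_thr f (Fx θ A) θ) (A ∪ B) ⊆
      Fx θ A ∪ Fx (refl_thr f (Fx θ (A ∩ B)) θ) B := by
  have hC := h.couple_inter hmono θ A B
  refine h.least _ _ _ (Finset.union_subset_union (h.sub _ _) (h.sub _ _)) ?_
  intro v hv
  by_contra hn
  rw [Finset.mem_union, not_or] at hn
  obtain ⟨hnA, hnB⟩ := hn
  have hnC : v ∉ Fx θ (A ∩ B) := fun hc => hnA (Finset.mem_inter.1 (hC hc)).1
  have h1 := mt (h.closed (refl_thr f (Fx θ (A ∩ B)) θ) B v) hnB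
  have h2 := hsub v (Fx θ A) (Fx (refl_thr f (Fx θ (A ∩ B)) θ) B)
  have h3 := hmono v _ _ hC
  have e1 : refl_thr f (Fx θ A) θ v = 1 + f v (Fx θ A) - θ v := by simp [refl_thr, hnA]
  have e2 : refl_thr f (Fx θ (A ∩ B)) θ v = 1 + f v (Fx θ (A ∩ B)) - θ v := by
    simp [refl_thr, hnC]
  rw [e1] at hv
  rw [e2] at h1
  linarith

/-- The part of the open cube on which the final set is `T`. -/
def cell (Fx : (V → ℝ) → Finset V → Finset V) (S T : Finset V) : Set (V → ℝ) :=
  {θ | Fx θ S = T} ∩ Set.univ.pi (fun _ => Set.Ioo (0:ℝ) 1)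

theorem cell_maps (h : IsFixOp f Fx)
    (h01 : ∀ (v : V) (S : Finset V), f v S ∈ Set.Icc (0:ℝ) 1)
    (hmono : ∀ v : V, ∀ S T : Finset V, S ⊆ T → f v S ≤ f v T) (S T : Finset V)
    (θ : V → ℝ) (hθ : θ ∈ cell Fx S T) : refl_thr f T θ ∈ cell Fx S T := by
  obtain ⟨rfl, hQ⟩ := hθ
  have hb : ∀ v ∉ Fx θ S, f v (Fx θ S) < θ v := fun v hv =>
    not_le.1 (mt (h.closed θ S v) hv)
  refine ⟨Finset.Subset.antisymm ?_ (h.sub_refl hmono θ S), ?_⟩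
  · refine h.least _ _ _ (h.sub _ _) ?_
    intro v hv
    by_contra hn
    simp only [refl_thr, hn, if_false] at hv
    have := (hQ v trivial).2
    linarith
  · intro v _
    have h1 := hQ v trivial
    by_cases hv : v ∈ Fx θ S
    · simpa [refl_thr, hv] using h1
    · simp only [refl_thr, hv, if_false]
      have := hb v hv
      have := (h01 v (Fx θ S)).1
      have := h1.2
      constructor <;> linarith

theorem measurableSet_fix [Fintype V] (h : IsFixOp f Fx) (S T : Finset V) :
    MeasurableSet {θ | Fx θ S = T} := by
  have : {θ | Fx θ S = T} = {θ | (S ⊆ T ∧ ∀ v, θ v ≤ f v T → v ∈ T) ∧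
      ∀ X : Finset V, S ⊆ X → (∀ v, θ v ≤ f v X → v ∈ X) → T ⊆ X} := by
    ext θ
    constructor
    · rintro rfl
      exact ⟨⟨h.sub _ _, h.closed _ _⟩, h.least _ _⟩
    · rintro ⟨⟨h1, h2⟩, h3⟩
      exact Finset.Subset.antisymm (h.least _ _ _ h1 h2) (h3 _ (h.sub _ _) (h.closed _ _))
  rw [this]
  have hc : ∀ X : Finset V, MeasurableSet {θ : V → ℝ | ∀ v, θ v ≤ f v X → v ∈ X} := by
    intro X
    refine measurableSet_setOfPred.2 (Measurable.forall fun v => ?_)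
    refine Measurable.imp ?_ measurable_const
    exact measurableSet_setOfPred.1 (measurableSet_le (measurable_pi_apply v) measurable_const)
  refine measurableSet_setOfPred.2 (Measurable.and (Measurable.and measurable_const
    (measurableSet_setOfPred.1 (hc T))) (Measurable.forall fun X => ?_))
  exact Measurable.imp measurable_const
    (Measurable.imp (measurableSet_setOfPred.1 (hc X)) measurable_const)

theorem measurable_wfix [Fintype V] (h : IsFixOp f Fx) (w : Finset V → ℝ) (S : Finset V) :
    Measurable (fun θ => w (Fx θ S)) := by
  letI : MeasurableSpace (Finset V) := ⊤
  have h1 : Measurable (fun θ => Fx θ S) :=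
    measurable_to_countable' fun T => measurableSet_fix h S T
  exact (measurable_from_top (f := w)).comp h1

theorem refl_thr_mp [Fintype V] (f : V → Finset V → ℝ) (T : Finset V) :
    MeasurePreserving (refl_thr f T) (volume : Measure (V → ℝ)) volume := by
  have : ∀ v : V, MeasurePreserving (fun x : ℝ => if v ∈ T then x else 1 + f v T - x)
      volume volume := by
    intro v
    by_cases hv : v ∈ T
    · simp only [hv, if_true]; exact MeasurePreserving.id _
    · simp only [hv, if_false]; exact Measure.measurePreserving_sub_left volume _
  have he : refl_thr f T = fun (θ : V → ℝ) v => if v ∈ T then θ v else 1 + f v T - θ v := by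
    funext θ v
    simp [refl_thr]
  rw [he]
  exact volume_preserving_pi this

theorem refl_thr_emb [Fintype V] (f : V → Finset V → ℝ) (T : Finset V) :
    MeasurableEmbedding (refl_thr f T) := by
  let e : (V → ℝ) ≃ᵐ (V → ℝ) :=
    { toFun := refl_thr f T
      invFun := refl_thr f T
      left_inv := refl_thr_invol f T
      right_inv := refl_thr_invol f T
      measurable_toFun := (refl_thr_mp f T).measurable
      measurable_invFun := (refl_thr_mp f T).measurable }
  exact e.measurableEmbedding

theorem cell_pre (h : IsFixOp f Fx)
    (h01 : ∀ (v : V) (S : Finset V), f v S ∈ Set.Icc (0:ℝ) 1)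
    (hmono : ∀ v : V, ∀ S T : Finset V, S ⊆ T → f v S ≤ f v T) (S T : Finset V) :
    refl_thr f T ⁻¹' cell Fx S T = cell Fx S T := by
  ext θ
  constructor
  · intro hθ
    have := cell_maps h h01 hmono S T _ hθ
    rwa [refl_thr_invol] at this
  · exact cell_maps h h01 hmono S T θ

theorem integral_refl [Fintype V] (h : IsFixOp f Fx)
    (h01 : ∀ (v : V) (S : Finset V), f v S ∈ Set.Icc (0:ℝ) 1)
    (hmono : ∀ v : V, ∀ S T : Finset V, S ⊆ T → f v S ≤ f v T) (S : Finset V)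
    (g : (V → ℝ) → ℝ)
    (hg : IntegrableOn g (Set.univ.pi (fun _ => Set.Ioo (0:ℝ) 1)) volume) :
    IntegrableOn (fun θ => g (refl_thr f (Fx θ S) θ))
        (Set.univ.pi (fun _ => Set.Ioo (0:ℝ) 1)) volume ∧
    ∫ θ in Set.univ.pi (fun _ => Set.Ioo (0:ℝ) 1), g (refl_thr f (Fx θ S) θ) =
      ∫ θ in Set.univ.pi (fun _ => Set.Ioo (0:ℝ) 1), g θ := by
  have hQ : Set.univ.pi (fun _ : V => Set.Ioo (0:ℝ) 1) = ⋃ T, cell Fx S T := by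
    ext θ; simp [cell]
  have hm : ∀ T, MeasurableSet (cell Fx S T) := fun T =>
    (measurableSet_fix h S T).inter (MeasurableSet.univ_pi fun _ => measurableSet_Ioo)
  have hd : Pairwise (Function.onFun Disjoint (cell Fx S)) := by
    intro T T' hne
    refine Set.disjoint_left.2 ?_
    rintro θ ⟨h1, _⟩ ⟨h2, _⟩
    exact hne (h1.symm.trans h2)
  have hgT : ∀ T, IntegrableOn g (cell Fx S T) volume := fun T =>
    hg.mono_set Set.inter_subset_right
  have hgR : ∀ T, IntegrableOn (fun θ => g (refl_thr f T θ)) (cell Fx S T) volume := by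
    intro T
    have := ((refl_thr_mp f T).integrableOn_comp_preimage (refl_thr_emb f T)
      (f := g) (s := cell Fx S T)).2 (hgT T)
    rwa [cell_pre h h01 hmono] at this
  have heq : ∀ T, Set.EqOn (fun θ => g (refl_thr f (Fx θ S) θ)) (fun θ => g (refl_thr f T θ))
      (cell Fx S T) := by
    rintro T θ ⟨h1, _⟩
    have h1 : Fx θ S = T := h1
    simp only [h1]
  have hgP : ∀ T, IntegrableOn (fun θ => g (refl_thr f (Fx θ S) θ)) (cell Fx S T) volume :=
    fun T => (integrableOn_congr_fun (heq T) (hm T)).2 (hgR T)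
  rw [hQ]
  refine ⟨integrableOn_finite_iUnion.2 hgP, ?_⟩
  rw [integral_iUnion_fintype hm hd hgP, integral_iUnion_fintype hm hd hgT]
  refine Finset.sum_congr rfl fun T _ => ?_
  rw [setIntegral_congr_fun (hm T) (heq T)]
  have := (refl_thr_mp f T).setIntegral_preimage_emb (refl_thr_emb f T) g (cell Fx S T)
  rwa [cell_pre h h01 hmono] at this

end

/-- Reflection of `(c, 1]` preserves the uniform measure on `[0,1]`. -/
theorem refl_one_mp (c : ℝ) (hc : c ∈ Set.Icc (0:ℝ) 1) :
    MeasurePreserving (fun x : ℝ => if x ≤ c then x else 1 + c - x)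
      (volume.restrict (Set.Icc (0:ℝ) 1)) (volume.restrict (Set.Icc (0:ℝ) 1)) := by
  have hmeas : Measurable (fun x : ℝ => if x ≤ c then x else 1 + c - x) :=
    Measurable.ite measurableSet_Iic measurable_id (measurable_const.sub measurable_id)
  refine ⟨hmeas, ?_⟩
  ext s hs
  rw [Measure.map_apply hmeas hs, Measure.restrict_apply (hmeas hs), Measure.restrict_apply hs]
  rw [← measure_inter_add_sdiff (s ∩ Set.Icc 0 1) (measurableSet_Iic (a := c)),
    ← measure_inter_add_sdiff (_ ∩ Set.Icc (0:ℝ) 1) (measurableSet_Iic (a := c))]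
  congr 1
  · congr 1
    ext x
    simp only [Set.mem_inter_iff, Set.mem_preimage, Set.mem_Iic]
    constructor
    · rintro ⟨⟨h1, h2⟩, h3⟩; rw [if_pos h3] at h1; exact ⟨⟨h1, h2⟩, h3⟩
    · rintro ⟨⟨h1, h2⟩, h3⟩; refine ⟨⟨?_, h2⟩, h3⟩; rwa [if_pos h3]
  · have e1 : ((fun x : ℝ => if x ≤ c then x else 1 + c - x) ⁻¹' s ∩ Set.Icc 0 1) \ Set.Iic c =
        (fun x : ℝ => 1 + c - x) ⁻¹' (s ∩ Set.Ico c 1) := by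
      ext x
      simp only [Set.mem_inter_iff, Set.mem_preimage, Set.mem_Iic, Set.mem_sdiff, Set.mem_Icc,
        Set.mem_Ico]
      constructor
      · rintro ⟨⟨h1, h2⟩, h3⟩
        rw [if_neg h3] at h1
        exact ⟨h1, by linarith, by linarith⟩
      · rintro ⟨h1, h2, h3⟩
        have h4 : ¬ x ≤ c := by intro h; linarith
        rw [if_neg h4]
        exact ⟨⟨h1, by linarith [hc.1], by linarith⟩, h4⟩
    have e2 : (s ∩ Set.Icc 0 1) \ Set.Iic c = s ∩ Set.Ioc c 1 := by
      ext x
      simp only [Set.mem_inter_iff, Set.mem_Iic, Set.mem_sdiff, Set.mem_Icc, Set.mem_Ioc, not_le]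
      constructor
      · rintro ⟨⟨h1, h2⟩, h3⟩; exact ⟨h1, h3, h2.2⟩
      · rintro ⟨h1, h2, h3⟩; exact ⟨⟨h1, by linarith [hc.1], h3⟩, h2⟩
    rw [e1, e2, (Measure.measurePreserving_sub_left volume (1 + c)).measure_preimage
      (hs.inter measurableSet_Ico).nullMeasurableSet]
    exact measure_congr ((ae_eq_refl s).inter Ico_ae_eq_Ioc)


open MeasureTheory in
open scoped Classical in
/-- Main theorem (Mossel–Roch): existence of a coupling dominating the intersection
and the union, and submodularity of the expected influence. -/
theorem influence_submodular {V : Type*} [DecidableEq V] [Fintype V]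
    (f : V → Finset V → ℝ)
    (h01 : ∀ (v : V) (S : Finset V), f v S ∈ Set.Icc (0:ℝ) 1)
    (h0 : ∀ v : V, f v ∅ = 0)
    (hmono : ∀ v : V, ∀ S T : Finset V, S ⊆ T → f v S ≤ f v T)
    (hsub : ∀ v : V, ∀ S T : Finset V, f v (S ∩ T) + f v (S ∪ T) ≤ f v S + f v T)
    (Fix : (V → ℝ) → Finset V → Finset V)
    (hFix : ∀ (θ : V → ℝ) (S : Finset V),
      Fix θ S = (fun T : Finset V =>
        T ∪ Finset.univ.filter (fun v => v ∉ T ∧ θ v ≤ f v T))^[Fintype.card V] S)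
    (w : Finset V → ℝ) (hw0 : ∀ S : Finset V, 0 ≤ w S)
    (hwmono : ∀ S T : Finset V, S ⊆ T → w S ≤ w T)
    (hwsub : ∀ S T : Finset V, w (S ∩ T) + w (S ∪ T) ≤ w S + w T)
    (μ : Measure (V → ℝ))
    (hμ : μ = Measure.pi (fun _ : V => volume.restrict (Set.Icc (0:ℝ) 1)))
    (σw : Finset V → ℝ)
    (hσ : ∀ S : Finset V, σw S = ∫ θ, w (Fix θ S) ∂μ)
    (A B : Finset V) :
    (∀ θ : V → ℝ, (∀ v, θ v ∈ Set.Icc (0:ℝ) 1) →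
      ∃ θA θB θC θD : V → ℝ,
        (∀ v, θA v = θ v ∨ ∃ g : ℝ → ℝ,
          MeasurePreserving g (volume.restrict (Set.Icc (0:ℝ) 1))
            (volume.restrict (Set.Icc (0:ℝ) 1)) ∧ θA v = g (θ v)) ∧
        (∀ v, θB v = θ v ∨ ∃ g : ℝ → ℝ,
          MeasurePreserving g (volume.restrict (Set.Icc (0:ℝ) 1))
            (volume.restrict (Set.Icc (0:ℝ) 1)) ∧ θB v = g (θ v)) ∧
        (∀ v, θC v = θ v ∨ ∃ g : ℝ → ℝ,
          MeasurePreserving g (volume.restrict (Set.Icc (0:ℝ) 1))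
            (volume.restrict (Set.Icc (0:ℝ) 1)) ∧ θC v = g (θ v)) ∧
        (∀ v, θD v = θ v ∨ ∃ g : ℝ → ℝ,
          MeasurePreserving g (volume.restrict (Set.Icc (0:ℝ) 1))
            (volume.restrict (Set.Icc (0:ℝ) 1)) ∧ θD v = g (θ v)) ∧
        Fix θC (A ∩ B) ⊆ Fix θA A ∩ Fix θB B ∧
        Fix θD (A ∪ B) ⊆ Fix θA A ∪ Fix θB B) ∧
    σw (A ∩ B) + σw (A ∪ B) ≤ σw A + σw B := by
  have hF : IsFixOp f Fix := by
    refine isFixOp_of_iter f hmono Fix _ ?_ hFix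
    intro θ T v
    simp only [Finset.mem_union, Finset.mem_filter, Finset.mem_univ, true_and]
    tauto
  have hone : ∀ (θ : V → ℝ) (S : Finset V) (v : V),
      refl_thr f (Fix θ S) θ v = θ v ∨ ∃ g : ℝ → ℝ,
          MeasurePreserving g (volume.restrict (Set.Icc (0:ℝ) 1))
            (volume.restrict (Set.Icc (0:ℝ) 1)) ∧ refl_thr f (Fix θ S) θ v = g (θ v) := by
    intro θ S v
    by_cases hv : v ∈ Fix θ S
    · left; simp [refl_thr, hv]
    · right
      refine ⟨_, refl_one_mp (f v (Fix θ S)) (h01 _ _), ?_⟩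
      have := mt (hF.closed θ S v) hv
      simp [refl_thr, hv, this]
  refine ⟨?_, ?_⟩
  · intro θ _
    exact ⟨θ, refl_thr f (Fix θ (A ∩ B)) θ, θ, refl_thr f (Fix θ A) θ,
      fun v => Or.inl rfl, hone θ _, fun v => Or.inl rfl, hone θ _,
      hF.couple_inter hmono θ A B, hF.couple_union hmono hsub θ A B⟩
  · have hμ' : μ = volume.restrict (Set.univ.pi (fun _ : V => Set.Ioo (0:ℝ) 1)) := by
      rw [hμ, volume_pi, Measure.restrict_pi_pi]
      congr 1
      funext _
      exact Measure.restrict_congr_set Ioo_ae_eq_Icc.symm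
    have hfin : IsFiniteMeasure μ := by
      rw [hμ]; infer_instance
    have hint : ∀ S, Integrable (fun θ => w (Fix θ S)) μ := by
      intro S
      refine Integrable.of_bound (measurable_wfix hF w S).aestronglyMeasurable
        (w Finset.univ) (Filter.Eventually.of_forall fun θ => ?_)
      rw [Real.norm_of_nonneg (hw0 _)]
      exact hwmono _ _ (Finset.subset_univ _)
    have hB := integral_refl hF h01 hmono (A ∩ B) (fun θ => w (Fix θ B))
      (by have := hint B; rwa [hμ'] at this)
    have hD := integral_refl hF h01 hmono A (fun θ => w (Fix θ (A ∪ B)))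
      (by have := hint (A ∪ B); rwa [hμ'] at this)
    unfold IntegrableOn at hB hD
    rw [← hμ'] at hB hD
    rw [hσ, hσ, hσ, hσ, ← hB.2, ← hD.2, ← integral_add (hint _) hD.1,
      ← integral_add (hint _) hB.1]
    refine integral_mono ((hint _).add hD.1) ((hint _).add hB.1) fun θ => ?_
    have h1 := hwmono _ _ (hF.couple_inter hmono θ A B)
    have h2 := hwmono _ _ (hF.couple_union hmono hsub θ A B)
    have h3 := hwsub (Fix θ A) (Fix (refl_thr f (Fix θ (A ∩ B)) θ) B)
    simp only [Pi.add_apply]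
    linarith
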